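/- arXiv:2412.09148 — 3 statements merged into one kernel-verified Lean document; each statement's English description precedes it below -/
import Mathlib

section
/- The Diophantine equation x⁴ − 17 = 2y² has no rational solutions: there are no x, y ∈ ℚ with x⁴ − 17 = 2y². -/
open NumberTheorySymbols in
/-- If `17 b⁴` is a fourth power modulo an odd `m` coprime to `b` and to `17`,
then `m` is a quadratic residue modulo `17`. -/
theorem jacobiSym_seventeen_eq_one {a b w : ℤ} {m : ℕ} (hm : Odd m)
    (hmw : (m : ℤ) ∣ w) (h : a ^ 4 - 17 * b ^ 4 = 2 * w ^ 2)
    (hb : b.gcd m = 1) (h17 : (17 : ℤ).gcd m = 1) : J(m | 17) = 1 := by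
  have hrec : J(m | 17) = J(17 | m) := by
    exact_mod_cast jacobiSym.quadratic_reciprocity_one_mod_four' (a := m) (b := 17) hm (by norm_num)
  have hmod : J(17 * b ^ 4 | m) = J(a ^ 4 | m) := by
    refine jacobiSym.mod_left' (Int.modEq_iff_dvd.mpr ?_)
    rw [h]
    exact (hmw.trans (dvd_pow_self w two_ne_zero)).mul_left 2
  have hb2 := jacobiSym.sq_one hb
  rw [jacobiSym.mul_left, jacobiSym.pow_left, jacobiSym.pow_left,
    show J(b | m) ^ 4 = (J(b | m) ^ 2) ^ 2 by ring, hb2] at hmod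
  rw [hrec]
  rcases jacobiSym.eq_one_or_neg_one h17 with h1 | h1
  · exact h1
  · have : 0 ≤ J(a | m) ^ 4 := by positivity
    rw [h1] at hmod
    lia

/-- `2` is not a fourth power modulo `17`. -/
theorem two_mul_pow_four_zmod_seventeen :
    ∀ s x : ZMod 17, x ^ 4 = 2 * (s * s) ^ 2 → s = 0 := by
  decide

/-- The equation `a⁴ - 17 b⁴ = 2 w²` has no solution in integers with `a` and `b` coprime. -/
theorem int_pow_four_sub_seventeen_mul_ne {a b w : ℤ} (hab : IsCoprime a b) :
    a ^ 4 - 17 * b ^ 4 ≠ 2 * w ^ 2 := by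
  intro h
  have hp17 : Prime (17 : ℤ) := by norm_num
  have hw17 : ¬ (17 : ℤ) ∣ w := by
    rintro ⟨v, rfl⟩
    obtain ⟨c, rfl⟩ : (17 : ℤ) ∣ a :=
      hp17.dvd_of_dvd_pow (n := 4) ⟨b ^ 4 + 34 * v ^ 2, by linarith⟩
    have hb : (17 : ℤ) ∣ b :=
      hp17.dvd_of_dvd_pow (n := 4) ⟨17 ^ 2 * c ^ 4 - 2 * v ^ 2, by linarith⟩
    exact hp17.not_isUnit (hab.isUnit_of_dvd' (dvd_mul_right _ _) hb)
  have hw0 : w.natAbs ≠ 0 := by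
    intro h0
    exact hw17 (by simp [Int.natAbs_eq_zero.mp h0])
  obtain ⟨k, m, hm, hkm⟩ := Nat.exists_eq_two_pow_mul_odd hw0
  have hmw : (m : ℤ) ∣ w := Int.natCast_dvd.mpr (hkm ▸ dvd_mul_left _ _)
  have hbm : b.gcd m = 1 := by
    rw [← Int.isCoprime_iff_gcd_eq_one]
    have hcop : IsCoprime b (a ^ 4 - 17 * b ^ 4) := by
      have := (hab.symm.pow_right (n := 4)).add_mul_left_right (-17 * b ^ 3)
      rwa [show a ^ 4 + b * (-17 * b ^ 3) = a ^ 4 - 17 * b ^ 4 by ring] at this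
    rw [h] at hcop
    exact hcop.of_isCoprime_of_dvd_right
      ((hmw.trans (dvd_pow_self w two_ne_zero)).mul_left 2)
  have h17m : (17 : ℤ).gcd m = 1 := by
    rw [← Int.isCoprime_iff_gcd_eq_one, hp17.coprime_iff_not_dvd]
    exact fun hd => hw17 (hd.trans hmw)
  have : Fact (Nat.Prime 17) := ⟨by norm_num⟩
  have hJ : jacobiSym w.natAbs 17 = 1 := by
    rw [hkm, Nat.cast_mul, jacobiSym.mul_left,
      jacobiSym_seventeen_eq_one hm hmw h hbm h17m, Nat.cast_pow, jacobiSym.pow_left,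
      Nat.cast_ofNat, show jacobiSym 2 17 = 1 by norm_num, one_pow, one_mul]
  obtain ⟨s, hs⟩ := ZMod.isSquare_of_jacobiSym_eq_one hJ
  have hs0 : s ≠ 0 := by
    rintro rfl
    rw [mul_zero, ZMod.intCast_zmod_eq_zero_iff_dvd] at hs
    exact hw17 (by simpa [Int.dvd_natAbs] using hs)
  have hZ : (a : ZMod 17) ^ 4 = 2 * (s * s) ^ 2 := by
    have h' := congrArg (Int.cast : ℤ → ZMod 17) h
    rw [← Int.natAbs_sq w] at h'
    push_cast at h' hs
    rw [hs, show (17 : ZMod 17) = 0 from rfl, zero_mul, sub_zero] at h'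
    exact h'
  exact hs0 (two_mul_pow_four_zmod_seventeen s a hZ)

/-- A rational number whose double square is an integer is itself an integer. -/
theorem Rat.exists_int_of_two_mul_sq_eq {q : ℚ} {n : ℤ} (h : 2 * q ^ 2 = n) :
    ∃ w : ℤ, q = w := by
  have hsq : IsSquare ((2 * n : ℤ) : ℚ) := ⟨2 * q, by push_cast; rw [← h]; ring⟩
  obtain ⟨r, hr⟩ := Rat.isSquare_intCast_iff.mp hsq
  obtain ⟨w, rfl⟩ : (2 : ℤ) ∣ r :=
    Int.prime_two.dvd_of_dvd_pow (n := 2) ⟨n, by rw [hr]; ring⟩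
  have hr' : (2 * n : ℚ) = 2 * w * (2 * w) := by exact_mod_cast hr
  rcases sq_eq_sq_iff_eq_or_eq_neg.mp (show q ^ 2 = (w : ℚ) ^ 2 by linarith) with hq | hq
  · exact ⟨w, hq⟩
  · exact ⟨-w, by rw [hq]; push_cast; rfl⟩


/-- The Diophantine equation `x⁴ − 17 = 2y²` has no rational solutions. -/
theorem no_rational_solutions_x4_minus_17_eq_2y2 :
    ¬ ∃ x y : ℚ, x ^ 4 - 17 = 2 * y ^ 2 := by
  rintro ⟨x, y, h⟩
  have hd : (x.den : ℚ) ≠ 0 := by exact_mod_cast x.den_ne_zero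
  have hx : x * x.den = x.num := Rat.mul_den_eq_num x
  have hxy : 2 * (x.den ^ 2 * y) ^ 2 = ((x.num ^ 4 - 17 * (x.den : ℤ) ^ 4 : ℤ) : ℚ) := by
    push_cast
    rw [← hx]
    linear_combination (-(x.den : ℚ) ^ 4) * h
  obtain ⟨w, hw⟩ := Rat.exists_int_of_two_mul_sq_eq hxy
  rw [hw] at hxy
  exact int_pow_four_sub_seventeen_mul_ne (Rat.isCoprime_num_den x) (by exact_mod_cast hxy.symm)
end

section
/- For every prime number p there exist elements x, y of the finite field F_p with x⁴ − 17 = 2y² (where 17 and 2 denote the images of these integers in F_p); moreover there exist x, y ∈ ℝ with x⁴ − 17 = 2y². -/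
section QuarticCharacterSum

variable {F : Type*} [Field F] [Fintype F] [DecidableEq F]

lemma sum_quadraticChar_sub_mul_sub_self (a : F) :
    ∑ c : F, quadraticChar F (a - c) * quadraticChar F (a - c) = Fintype.card F - 1 := by
  have h (c : F) : quadraticChar F (a - c) * quadraticChar F (a - c)
      = 1 - if a = c then 1 else 0 := by
    split_ifs with hc
    · simp [hc]
    · rw [← sq, quadraticChar_sq_one (sub_ne_zero.mpr hc), sub_zero]
  simp_rw [h]
  simp

lemma sum_quadraticChar_sub_mul_sub_of_ne (hF : ringChar F ≠ 2) {a b : F} (hab : a ≠ b) :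
    ∑ c : F, quadraticChar F (a - c) * quadraticChar F (b - c) = -1 := by
  have hd : a - b ≠ 0 := sub_ne_zero.mpr hab
  have hJ : jacobiSum (quadraticChar F) (quadraticChar F) = -quadraticChar F (-1) := by
    simpa only [(quadraticChar_isQuadratic F).inv] using
      jacobiSum_nontrivial_inv (quadraticChar_ne_one hF)
  rw [← ((Equiv.mulLeft₀ (a - b) hd).trans (Equiv.subLeft a)).sum_comp]
  have h (x : F) : quadraticChar F (a - (a - (a - b) * x)) *
      quadraticChar F (b - (a - (a - b) * x)) =
      quadraticChar F (-1) * (quadraticChar F x * quadraticChar F (1 - x)) := by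
    have h₁ : a - (a - (a - b) * x) = (a - b) * x := by ring
    have h₂ : b - (a - (a - b) * x) = (a - b) * (-1 * (1 - x)) := by ring
    rw [h₁, h₂, map_mul, map_mul, map_mul]
    linear_combination (quadraticChar F (-1) * quadraticChar F x * quadraticChar F (1 - x)) *
      quadraticChar_sq_one hd
  calc _ = ∑ x : F, quadraticChar F (-1) * (quadraticChar F x * quadraticChar F (1 - x)) :=
        Finset.sum_congr rfl fun x _ ↦ h x
    _ = quadraticChar F (-1) * jacobiSum (quadraticChar F) (quadraticChar F) := by
        rw [← Finset.mul_sum, jacobiSum]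
    _ = -1 := by
        rw [hJ]
        linear_combination -quadraticChar_sq_one (F := F) (neg_ne_zero.mpr one_ne_zero)

lemma card_filter_mul_pow_four_eq_le {a : F} (ha : a ≠ 0) (c : F) :
    (Finset.univ.filter fun t : F ↦ a * t ^ 4 = c).card ≤ 4 := by
  refine le_trans (Finset.card_le_card fun t ht ↦ ?_) <|
    (Multiset.toFinset_card_le _).trans (Polynomial.card_nthRoots 4 (a⁻¹ * c))
  rw [Finset.mem_filter_univ] at ht
  rw [Multiset.mem_toFinset, Polynomial.mem_nthRoots (by norm_num), ← ht, inv_mul_cancel_left₀ ha]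

lemma sum_sq_sum_quadraticChar_pow_four_sub_le (hF : ringChar F ≠ 2) :
    ∑ c : F, (∑ x : F, quadraticChar F (x ^ 4 - c)) ^ 2 ≤ 3 * (Fintype.card F : ℤ) ^ 2 := by
  have h (x y : F) : ∑ c : F, quadraticChar F (x ^ 4 - c) * quadraticChar F (y ^ 4 - c) =
      Fintype.card F * (if 1 * y ^ 4 = x ^ 4 then 1 else 0) - 1 := by
    rw [one_mul]
    split_ifs with hxy
    · rw [hxy, sum_quadraticChar_sub_mul_sub_self, mul_one]
    · rw [sum_quadraticChar_sub_mul_sub_of_ne hF (Ne.symm hxy), mul_zero, zero_sub]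
  calc ∑ c : F, (∑ x : F, quadraticChar F (x ^ 4 - c)) ^ 2
      = ∑ x : F, ∑ y : F, ∑ c : F,
          quadraticChar F (x ^ 4 - c) * quadraticChar F (y ^ 4 - c) := by
        simp_rw [sq, Finset.sum_mul_sum]
        rw [Finset.sum_comm]
        exact Finset.sum_congr rfl fun x _ ↦ Finset.sum_comm
    _ = ∑ x : F, ((Fintype.card F : ℤ) *
          (Finset.univ.filter fun y : F ↦ 1 * y ^ 4 = x ^ 4).card - Fintype.card F) := by
        simp_rw [h, Finset.sum_sub_distrib, ← Finset.mul_sum, Finset.sum_boole]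
        simp
    _ ≤ ∑ _x : F, ((Fintype.card F : ℤ) * 4 - Fintype.card F) := by
        gcongr with x
        exact_mod_cast card_filter_mul_pow_four_eq_le one_ne_zero (x ^ 4)
    _ = 3 * (Fintype.card F : ℤ) ^ 2 := by
        rw [Finset.sum_const, Finset.card_univ, nsmul_eq_mul]
        ring

/-- The second moment bound for `c ↦ ∑ x, χ (x ^ 4 - c)` forces `x ^ 4 - a = b * y ^ 2` to be
solvable, as otherwise this sum would be `± q` at all of the values `c = a * t ^ 4`. -/
theorem exists_pow_four_sub_eq_mul_sq (hF : ringChar F ≠ 2) (hcard : 13 < Fintype.card F)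
    {a b : F} (ha : a ≠ 0) (hb : b ≠ 0) : ∃ x y : F, x ^ 4 - a = b * y ^ 2 := by
  by_contra! hne
  set S : F → ℤ := fun c ↦ ∑ x : F, quadraticChar F (x ^ 4 - c) with hS
  have hval (t : F) (ht : t ≠ 0) : S (a * t ^ 4) ^ 2 = (Fintype.card F : ℤ) ^ 2 := by
    have hchar (x : F) : quadraticChar F (x ^ 4 - a * t ^ 4) = -quadraticChar F b := by
      have hns : ¬ IsSquare (b * (x ^ 4 - a * t ^ 4)) := by
        rintro ⟨r, hr⟩
        refine hne (x / t) (r / (b * t ^ 2)) ?_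
        field_simp
        linear_combination hr
      have := quadraticChar_neg_one_iff_not_isSquare.mpr hns
      rw [map_mul] at this
      linear_combination quadraticChar F b * this -
        quadraticChar F (x ^ 4 - a * t ^ 4) * quadraticChar_sq_one hb
    simp only [hS, hchar, Finset.sum_const, Finset.card_univ, nsmul_eq_mul]
    linear_combination (Fintype.card F : ℤ) ^ 2 * quadraticChar_sq_one hb
  have hlower : ((Fintype.card F : ℤ) - 1) * (Fintype.card F : ℤ) ^ 2 ≤
      ∑ t : F, S (a * t ^ 4) ^ 2 := by
    calc ((Fintype.card F : ℤ) - 1) * (Fintype.card F : ℤ) ^ 2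
        = ∑ t ∈ Finset.univ.erase (0 : F), S (a * t ^ 4) ^ 2 := by
          rw [Finset.sum_congr rfl fun t ht ↦ hval t (Finset.ne_of_mem_erase ht),
            Finset.sum_const, Finset.card_erase_of_mem (Finset.mem_univ _), Finset.card_univ,
            nsmul_eq_mul, Nat.cast_sub Fintype.card_pos, Nat.cast_one]
      _ ≤ ∑ t : F, S (a * t ^ 4) ^ 2 :=
          Finset.sum_le_sum_of_subset_of_nonneg (Finset.erase_subset _ _)
            fun _ _ _ ↦ sq_nonneg _
  have hupper : ∑ t : F, S (a * t ^ 4) ^ 2 ≤ 4 * ∑ c : F, S c ^ 2 := by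
    rw [← Finset.sum_fiberwise Finset.univ (fun t : F ↦ a * t ^ 4), Finset.mul_sum]
    refine Finset.sum_le_sum fun c _ ↦ ?_
    rw [Finset.sum_congr rfl fun t ht ↦ by rw [(Finset.mem_filter.mp ht).2],
      Finset.sum_const, nsmul_eq_mul]
    gcongr
    exact_mod_cast card_filter_mul_pow_four_eq_le ha c
  have hq : (13 : ℤ) < Fintype.card F := by exact_mod_cast hcard
  have := sum_sq_sum_quadraticChar_pow_four_sub_le hF
  nlinarith [pow_pos (show (0 : ℤ) < Fintype.card F by linarith) 2]

end QuarticCharacterSum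

/-- The equation `x⁴ − 17 = 2y²` is solvable in every finite field `F_p` and over `ℝ`. -/
theorem local_solvability_x4_minus_17_eq_2y2 :
    (∀ p : ℕ, p.Prime → ∃ x y : ZMod p, x ^ 4 - 17 = 2 * y ^ 2) ∧
      (∃ x y : ℝ, x ^ 4 - 17 = 2 * y ^ 2) := by
  refine ⟨fun p hp ↦ ?_, 3, √32, by norm_num⟩
  have : Fact p.Prime := ⟨hp⟩
  rcases le_or_gt p 13 with hle | hlt
  · interval_cases p <;> first | decide | exact absurd hp (by norm_num)
  by_cases h17 : (17 : ZMod p) = 0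
  · exact ⟨0, 0, by simp [h17]⟩
  have hchar : ringChar (ZMod p) ≠ 2 := by
    rw [ZMod.ringChar_zmod_n]
    omega
  exact exists_pow_four_sub_eq_mul_sq hchar (by rwa [ZMod.card]) h17 (Ring.two_ne_zero hchar)
end

section
/- Let p(x) ∈ ℤ[x] be a monic irreducible polynomial of degree n. Then the set of matrices B ∈ Mₙ(ℤ) whose characteristic polynomial equals p(x), considered up to conjugation by matrices in GL(n, ℤ), is finite; that is, the matrices in Mₙ(ℤ) with characteristic polynomial p(x) fall into finitely many GL(n, ℤ)-similarity classes. -/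
open Polynomial Matrix

/-- Two integer matrices are similar over `ℤ` if they are conjugate by a matrix in `GL(n, ℤ)`. -/
def GLIntSimilar (n : ℕ) (A B : Matrix (Fin n) (Fin n) ℤ) : Prop :=
  ∃ U : GL (Fin n) ℤ, B = (U : Matrix (Fin n) (Fin n) ℤ) * A * ((U⁻¹ : GL (Fin n) ℤ) : Matrix (Fin n) (Fin n) ℤ)

/-- In a domain `S` finite free over `ℤ`, a fixed nonzero integer `m` multiplies every nonzero
ideal into a principal ideal generated by one of its elements. -/
theorem exists_int_forall_ideal_dvd_mul {S ι : Type*} [CommRing S] [IsDomain S] [Fintype ι]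
    (bS : Module.Basis ι ℤ S) :
    ∃ m : ℤ, (m : S) ≠ 0 ∧ ∀ I : Ideal S, I ≠ ⊥ → ∃ b ∈ I, b ≠ 0 ∧ ∀ a ∈ I, b ∣ m * a := by
  classical
  have : Module.Finite ℤ S := Module.Finite.of_basis bS
  have : Algebra.IsAlgebraic ℤ S := Algebra.IsIntegral.isAlgebraic
  let adm := AbsoluteValue.absIsAdmissible
  refine ⟨∏ r ∈ ClassGroup.finsetApprox bS adm, r, ?_, fun I hI => ?_⟩
  · simpa using ClassGroup.prod_finsetApprox_ne_zero bS adm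
  obtain ⟨b, hbI, hb, hmin⟩ := ClassGroup.exists_min AbsoluteValue.abs
    ⟨I, mem_nonZeroDivisors_of_ne_zero hI⟩
  refine ⟨b, hbI, hb, fun a ha => ?_⟩
  obtain ⟨q, r, hr, hlt⟩ := ClassGroup.exists_mem_finset_approx' bS adm a hb
  have hmem : r • a - q * b ∈ I := I.sub_mem (zsmul_mem ha r) (I.mul_mem_left q hbI)
  have hra : (r : S) * a = q * b := by simpa [sub_eq_zero] using hmin _ hmem hlt
  have hdvd : (r : S) ∣ ((∏ r ∈ ClassGroup.finsetApprox bS adm, r : ℤ) : S) :=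
    map_dvd (Int.castRingHom S) (Finset.dvd_prod_of_mem _ hr)
  exact (Dvd.intro_left q hra.symm).trans (mul_dvd_mul_right hdvd a)

/-- Only finitely many ideals contain a given nonzero integer. -/
theorem finite_ideals_containing_int {S : Type*} [CommRing S] [Module.Finite ℤ S] {m : ℤ}
    (hm : m ≠ 0) : Finite {J : Ideal S // (m : S) ∈ J} := by
  have htors : Module.IsTorsion ℤ (S ⧸ Ideal.span {(m : S)}) := by
    intro x
    refine ⟨⟨m, mem_nonZeroDivisors_of_ne_zero hm⟩, ?_⟩
    obtain ⟨s, rfl⟩ := Ideal.Quotient.mk_surjective x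
    change m • Ideal.Quotient.mk _ s = 0
    rw [← map_zsmul, Ideal.Quotient.eq_zero_iff_mem, zsmul_eq_mul]
    exact Ideal.mul_mem_right _ _ (Ideal.mem_span_singleton_self _)
  have : Finite (S ⧸ Ideal.span {(m : S)}) := Module.finite_of_fg_torsion _ htors
  have : Finite (Ideal (S ⧸ Ideal.span {(m : S)})) :=
    Finite.of_injective _ SetLike.coe_injective
  refine Finite.of_injective
    (fun J : {J : Ideal S // (m : S) ∈ J} => J.1.map (Ideal.Quotient.mk (Ideal.span {(m : S)}))) ?_
  intro J K h
  have key : ∀ L : {J : Ideal S // (m : S) ∈ J},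
      (L.1.map (Ideal.Quotient.mk (Ideal.span {(m : S)}))).comap (Ideal.Quotient.mk _) = L.1 :=
    fun L => Ideal.comap_map_quotientMk _ _ |>.trans
      (sup_eq_right.mpr ((Ideal.span_singleton_le_iff_mem _).mpr L.2))
  apply Subtype.ext
  rw [← key J, ← key K]
  exact congrArg _ h

/-- The `ℤ`-span of the entries of an eigenvector for `θ` is an ideal when `θ` generates the
ring. -/
theorem exists_ideal_restrictScalars_eq_span {S ι : Type*} [CommRing S] [Fintype ι] {θ : S}
    (hθ : Algebra.adjoin ℤ {θ} = ⊤) {v : ι → S} {B : Matrix ι ι ℤ}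
    (hv : v ᵥ* B.map (Int.cast : ℤ → S) = θ • v) :
    ∃ I : Ideal S, I.restrictScalars ℤ = Submodule.span ℤ (Set.range v) := by
  set N := Submodule.span ℤ (Set.range v) with hN
  have hθN : ∀ x ∈ N, θ * x ∈ N := by
    intro x hx
    induction hx using Submodule.span_induction with
    | mem x hx =>
      obtain ⟨j, rfl⟩ := hx
      have h : ∑ i, v i * (B i j : S) = θ * v j := congrFun hv j
      rw [← h]
      refine N.sum_mem fun i _ => ?_
      rw [mul_comm, ← zsmul_eq_mul]
      exact N.smul_mem _ (Submodule.subset_span ⟨i, rfl⟩)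
    | zero => simp
    | add x y _ _ hx hy => rw [mul_add]; exact N.add_mem hx hy
    | smul c x _ hx => rw [mul_smul_comm]; exact N.smul_mem c hx
  have hSN : ∀ s : S, ∀ x ∈ N, s * x ∈ N := by
    intro s
    have hs : s ∈ Algebra.adjoin ℤ {θ} := hθ ▸ Algebra.mem_top
    induction hs using Algebra.adjoin_induction with
    | mem y hy => rw [Set.mem_singleton_iff.mp hy]; exact hθN
    | algebraMap r => intro x hx; rw [← Algebra.smul_def]; exact N.smul_mem r hx
    | add a b _ _ ha hb => intro x hx; rw [add_mul]; exact N.add_mem (ha x hx) (hb x hx)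
    | mul a b _ _ ha hb => intro x hx; rw [mul_assoc]; exact ha _ (hb x hx)
  exact ⟨{ N with smul_mem' := fun s x hx => hSN s x hx }, rfl⟩

/-- A family spanning a nonzero ideal over `ℤ`, with as many members as the rank of the ring, is
linearly independent. -/
theorem linearIndependent_of_span_eq_ideal {S ι : Type*} [CommRing S] [IsDomain S] [Fintype ι]
    (bS : Module.Basis ι ℤ S) {I : Ideal S} (hI : I ≠ ⊥) {v : ι → S}
    (hspan : I.restrictScalars ℤ = Submodule.span ℤ (Set.range v)) :
    LinearIndependent ℤ v := by
  have hrank : Fintype.card ι = Module.finrank ℤ (Submodule.span ℤ (Set.range v)) := by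
    rw [← hspan]
    exact (Module.finrank_eq_card_basis (Ideal.selfBasis bS I hI)).symm
  exact linearIndependent_iff_card_le_finrank_span.mpr hrank.le

/-- Integer matrices acting on a linearly independent row vector are determined by the result. -/
theorem LinearIndependent.vecMul_intCast_injective {S ι κ : Type*} [CommRing S] [Fintype ι]
    {u : ι → S} (hu : LinearIndependent ℤ u) {X Y : Matrix ι κ ℤ}
    (h : u ᵥ* X.map (Int.cast : ℤ → S) = u ᵥ* Y.map (Int.cast : ℤ → S)) : X = Y := by
  ext i j
  have hj : ∑ i, u i * (X i j : S) = ∑ i, u i * (Y i j : S) := congrFun h j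
  refine sub_eq_zero.mp (Fintype.linearIndependent_iff.mp hu (fun i => X i j - Y i j) ?_ i)
  simp_rw [sub_smul, zsmul_eq_mul, Finset.sum_sub_distrib, mul_comm _ (u _)]
  exact sub_eq_zero.mpr hj

theorem exists_vecMul_intCast_eq_of_mem_span {S ι κ : Type*} [CommRing S] [Fintype ι]
    {u : ι → S} {w : κ → S} (h : ∀ j, w j ∈ Submodule.span ℤ (Set.range u)) :
    ∃ P : Matrix ι κ ℤ, u ᵥ* P.map (Int.cast : ℤ → S) = w := by
  choose c hc using fun j => (Submodule.mem_span_range_iff_exists_fun ℤ).mp (h j)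
  refine ⟨Matrix.of fun i j => c j i, funext fun j => ?_⟩
  rw [← hc j]
  change ∑ i, u i * (c j i : S) = _
  simp [mul_comm]

theorem Matrix.vecMul_map_intCast_mul {S ι κ μ : Type*} [CommRing S] [Fintype ι] [Fintype κ]
    (u : ι → S) (X : Matrix ι κ ℤ) (Y : Matrix κ μ ℤ) :
    u ᵥ* (X * Y).map (Int.cast : ℤ → S) =
      u ᵥ* X.map (Int.cast : ℤ → S) ᵥ* Y.map (Int.cast : ℤ → S) := by
  rw [Matrix.vecMul_vecMul]
  exact congrArg (u ᵥ* ·) (Matrix.map_mul (f := Int.castRingHom S))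

/-- Matrices of multiplication by `θ` in two bases of the same lattice are similar over `ℤ`. -/
theorem GLIntSimilar.of_span_eq {S : Type*} [CommRing S] {n : ℕ} {θ : S} {u w : Fin n → S}
    {A B : Matrix (Fin n) (Fin n) ℤ} (hu : LinearIndependent ℤ u) (hw : LinearIndependent ℤ w)
    (hA : u ᵥ* A.map (Int.cast : ℤ → S) = θ • u) (hB : w ᵥ* B.map (Int.cast : ℤ → S) = θ • w)
    (hspan : Submodule.span ℤ (Set.range u) = Submodule.span ℤ (Set.range w)) :
    GLIntSimilar n A B := by
  obtain ⟨P, hP⟩ := exists_vecMul_intCast_eq_of_mem_span (u := u) (w := w) fun j =>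
    hspan ▸ Submodule.subset_span ⟨j, rfl⟩
  obtain ⟨Q, hQ⟩ := exists_vecMul_intCast_eq_of_mem_span (u := w) (w := u) fun j =>
    hspan ▸ Submodule.subset_span ⟨j, rfl⟩
  have hPQ : P * Q = 1 := hu.vecMul_intCast_injective (by
    rw [Matrix.vecMul_map_intCast_mul, hP, hQ]; simp)
  have hQP : Q * P = 1 := hw.vecMul_intCast_injective (by
    rw [Matrix.vecMul_map_intCast_mul, hQ, hP]; simp)
  have hcomm : A * P = P * B := hu.vecMul_intCast_injective (by
    rw [Matrix.vecMul_map_intCast_mul, Matrix.vecMul_map_intCast_mul, hA, hP, hB, Matrix.smul_vecMul, hP])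
  refine ⟨⟨Q, P, hQP, hPQ⟩, ?_⟩
  change B = Q * A * P
  rw [mul_assoc, hcomm, ← mul_assoc, hQP, one_mul]

/-- An integer matrix has a nonzero left eigenvector for each root of its characteristic
polynomial in a domain. -/
theorem exists_left_eigenvector {S ι : Type*} [CommRing S] [IsDomain S] [Fintype ι]
    [DecidableEq ι] {θ : S} {B : Matrix ι ι ℤ} (hroot : aeval θ B.charpoly = 0) :
    ∃ v : ι → S, v ≠ 0 ∧ v ᵥ* B.map (Int.cast : ℤ → S) = θ • v := by
  have hdet : (Matrix.scalar ι θ - B.map (Int.cast : ℤ → S)).det = 0 := by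
    rw [← Matrix.eval_charpoly, ← hroot]
    have h := Matrix.charpoly_map B (Int.castRingHom S)
    rw [Int.coe_castRingHom] at h
    rw [h, Polynomial.eval_map, Polynomial.aeval_def]
    rfl
  obtain ⟨v, hv, h⟩ := Matrix.exists_vecMul_eq_zero_iff.mpr hdet
  refine ⟨v, hv, ?_⟩
  rw [Matrix.vecMul_sub, sub_eq_zero] at h
  rw [← h]
  ext j
  simp [Matrix.vecMul_diagonal, mul_comm]

/-- An integer matrix annihilated at `θ` by its characteristic polynomial is the matrix of
multiplication by `θ` in a basis of an ideal containing the integer `m`. -/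
theorem exists_basis_of_ideal_containing_int {S ι : Type*} [CommRing S] [IsDomain S]
    [Fintype ι] [DecidableEq ι] (bS : Module.Basis ι ℤ S) {m : ℤ} (hm : (m : S) ≠ 0)
    (hdvd : ∀ I : Ideal S, I ≠ ⊥ → ∃ b ∈ I, b ≠ 0 ∧ ∀ a ∈ I, b ∣ m * a)
    {θ : S} (hθ : Algebra.adjoin ℤ {θ} = ⊤) {B : Matrix ι ι ℤ}
    (hroot : aeval θ B.charpoly = 0) :
    ∃ (u : ι → S) (J : Ideal S), LinearIndependent ℤ u ∧
      u ᵥ* B.map (Int.cast : ℤ → S) = θ • u ∧ (m : S) ∈ J ∧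
      J.restrictScalars ℤ = Submodule.span ℤ (Set.range u) := by
  obtain ⟨v, hv0, hv⟩ := exists_left_eigenvector hroot
  obtain ⟨I, hI⟩ := exists_ideal_restrictScalars_eq_span hθ hv
  have hvI : ∀ j, v j ∈ I := fun j => by
    have : v j ∈ I.restrictScalars ℤ := hI ▸ Submodule.subset_span ⟨j, rfl⟩
    exact this
  have hI0 : I ≠ ⊥ := by
    rintro rfl
    exact hv0 (funext hvI)
  obtain ⟨b, hbI, hb, hbdvd⟩ := hdvd I hI0
  choose u hu using fun j => hbdvd (v j) (hvI j)
  have hbu : b • u = (m : S) • v := funext fun j => (hu j).symm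
  have hueig : u ᵥ* B.map (Int.cast : ℤ → S) = θ • u := by
    refine smul_right_injective _ hb ?_
    change b • (u ᵥ* _) = b • θ • u
    rw [← Matrix.smul_vecMul, hbu, Matrix.smul_vecMul, hv, smul_comm b, hbu, smul_comm θ]
  obtain ⟨J, hJ⟩ := exists_ideal_restrictScalars_eq_span hθ hueig
  have hmJ : (m : S) ∈ J := by
    have hb' : b ∈ Submodule.span ℤ (Set.range v) := hI ▸ hbI
    obtain ⟨c, hc⟩ := (Submodule.mem_span_range_iff_exists_fun ℤ).mp hb'
    have hmc : ∑ j, c j • u j = (m : S) := by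
      refine mul_left_cancel₀ hb ?_
      rw [Finset.mul_sum]
      simp_rw [mul_smul_comm, ← hu, ← mul_smul_comm]
      rw [← Finset.mul_sum, hc, mul_comm]
    have : (m : S) ∈ J.restrictScalars ℤ :=
      hJ ▸ (Submodule.mem_span_range_iff_exists_fun ℤ).mpr ⟨c, hmc⟩
    exact this
  have hJ0 : J ≠ ⊥ := by
    rintro rfl
    exact hm hmJ
  exact ⟨u, J, linearIndependent_of_span_eq_ideal bS hJ0 hJ, hueig, hmJ, hJ⟩

/-- For a monic irreducible `p(x) ∈ ℤ[x]` of degree `n`, the integer matrices with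
characteristic polynomial `p(x)` fall into finitely many `GL(n, ℤ)`-similarity classes. -/
theorem finitely_many_similarity_classes (n : ℕ) (p : Polynomial ℤ)
    (hmonic : p.Monic) (hirr : Irreducible p) (hdeg : p.natDegree = n) :
    Finite (Quot (fun A B : {B : Matrix (Fin n) (Fin n) ℤ // B.charpoly = p} =>
      GLIntSimilar n (A : Matrix (Fin n) (Fin n) ℤ) (B : Matrix (Fin n) (Fin n) ℤ))) := by
  have : IsDomain (AdjoinRoot p) := AdjoinRoot.isDomain_of_prime hirr.prime
  let bS : Module.Basis (Fin n) ℤ (AdjoinRoot p) :=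
    (AdjoinRoot.powerBasisAux' hmonic).reindex (finCongr hdeg)
  have : Module.Finite ℤ (AdjoinRoot p) := Module.Finite.of_basis bS
  obtain ⟨m, hm, hdvd⟩ := exists_int_forall_ideal_dvd_mul bS
  have hm0 : m ≠ 0 := by
    rintro rfl
    exact hm Int.cast_zero
  have hroot : ∀ B : {B : Matrix (Fin n) (Fin n) ℤ // B.charpoly = p},
      aeval (AdjoinRoot.root p) B.1.charpoly = 0 := fun B => by
    rw [B.2, AdjoinRoot.aeval_eq, AdjoinRoot.mk_self]
  choose u J hu heig hmJ hJ using fun B =>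
    exists_basis_of_ideal_containing_int bS hm hdvd AdjoinRoot.adjoinRoot_eq_top (hroot B)
  have := finite_ideals_containing_int (S := AdjoinRoot p) hm0
  refine Finite.of_injective
    (fun q => (⟨J q.out, hmJ q.out⟩ : {J : Ideal (AdjoinRoot p) // (m : AdjoinRoot p) ∈ J})) ?_
  intro q r hqr
  rw [← Quot.out_eq q, ← Quot.out_eq r]
  refine Quot.sound (GLIntSimilar.of_span_eq (hu _) (hu _) (heig _) (heig _) ?_)
  rw [← hJ, ← hJ, Subtype.mk.inj hqr]
end
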